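/- arXiv:1606.06208 — 6 statements merged into one kernel-verified Lean document; each statement's English description precedes it below -/
import Mathlib

section
/- Let R be a real 3×3 rotation matrix (RᵀR = I, det R = 1). Then ‖ψ(R)‖² = |R²|_I² = 4|R|_I²(1 − |R|_I²), where R² is the matrix square of R. -/
open Matrix Filter

noncomputable section

attribute [local instance] Matrix.normedAddCommGroup Matrix.normedSpace

/-- 3×3 real matrices. -/
abbrev M3 := Matrix (Fin 3) (Fin 3) ℝ
/-- vectors in ℝ³. -/
abbrev V3 := Fin 3 → ℝ

/-- `R ∈ SO(3)`: `RᵀR = I` and `det R = 1`. -/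
def SO3 (R : M3) : Prop := Rᵀ * R = 1 ∧ R.det = 1

/-- The skew-symmetric matrix `[x]ₓ` with `[x]ₓ y = x × y`. -/
def skew (x : V3) : M3 :=
  !![0, -x 2, x 1; x 2, 0, -x 0; -x 1, x 0, 0]

/-- Inverse of `skew` on skew-symmetric matrices. -/
def vex (M : M3) : V3 := ![M 2 1, M 0 2, M 1 0]

/-- Anti-symmetric projection `P_a(M) = (M - Mᵀ)/2`. -/
def Pa (M : M3) : M3 := (2:ℝ)⁻¹ • (M - Mᵀ)

/-- `ψ(M) = vex(P_a(M))`. -/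
def psi (M : M3) : V3 := vex (Pa M)

/-- Squared normalized Euclidean distance `|R|_I² = tr(I - R)/4`. -/
def normI2 (R : M3) : ℝ := (1 - R).trace / 4

/-- Rodrigues vector `Z(R) = ψ(R)/(2(1 - |R|_I²))`. -/
def Zof (R : M3) : V3 := (2 * (1 - normI2 R))⁻¹ • psi R

/-- Cayley map `R_r(z) = (I + [z]ₓ)(I - [z]ₓ)⁻¹`. -/
def Rr (z : V3) : M3 := (1 + skew z) * (1 - skew z)⁻¹

/-- Angle-axis map `R_a(θ,u) = I + sin θ [u]ₓ + (1 - cos θ)[u]ₓ²`. -/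
def Ra (θ : ℝ) (u : V3) : M3 :=
  1 + Real.sin θ • skew u + (1 - Real.cos θ) • (skew u * skew u)

/-- `g(z) = (1/2)(I + [z]ₓ + z zᵀ)`. -/
def gmat (z : V3) : M3 := (2:ℝ)⁻¹ • ((1 : M3) + skew z + vecMulVec z z)

/-- `Ā = (tr(A) I - A)/2`. -/
def Abar (A : M3) : M3 := (2:ℝ)⁻¹ • (A.trace • (1 : M3) - A)

/-- smallest eigenvalue of a positive-definite symmetric real matrix. -/
def lmin {B : M3} (hB : B.PosDef) : ℝ := ⨅ i, hB.1.eigenvalues i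

/-- largest eigenvalue of a positive-definite symmetric real matrix. -/
def lmax {B : M3} (hB : B.PosDef) : ℝ := ⨆ i, hB.1.eigenvalues i

/-- A rotation matrix is its own cofactor matrix. -/
lemma SO3.adjugate_eq_transpose {R : M3} (hR : SO3 R) : R.adjugate = Rᵀ := by
  calc R.adjugate = Rᵀ * R * R.adjugate := by rw [hR.1, one_mul]
    _ = Rᵀ := by rw [Matrix.mul_assoc, mul_adjugate, hR.2, one_smul, mul_one]

/-- The second elementary symmetric function of the eigenvalues of `M` is `tr (adj M)`. -/
lemma trace_mul_self_eq (M : M3) :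
    (M * M).trace = M.trace ^ 2 - 2 * M.adjugate.trace := by
  simp [trace_fin_three, adjugate_fin_three, mul_apply, Fin.sum_univ_three]
  ring

lemma normI2_eq (M : M3) : normI2 M = (3 - M.trace) / 4 := by
  simp [normI2, trace_sub]

lemma psi_dotProduct_self (M : M3) :
    psi M ⬝ᵥ psi M = ((Mᵀ * M).trace - (M * M).trace) / 4 := by
  simp [psi, vex, Pa, dotProduct, trace_fin_three, mul_apply, Fin.sum_univ_three]
  ring

/-- for `R ∈ SO(3)`, `‖ψ(R)‖² = |R²|_I² = 4|R|_I²(1 − |R|_I²)`. -/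
theorem stmt0 (R : M3) (hR : SO3 R) :
    psi R ⬝ᵥ psi R = normI2 (R * R) ∧
    normI2 (R * R) = 4 * normI2 R * (1 - normI2 R) := by
  constructor
  · rw [psi_dotProduct_self, hR.1, normI2_eq]
    simp
  · rw [normI2_eq, normI2_eq, trace_mul_self_eq, hR.adjugate_eq_transpose, trace_transpose]
    ring

end
end

section
/- For every z ∈ ℝ³ the matrix I − [z]_× is invertible, the matrix R_r(z) := (I + [z]_×)(I − [z]_×)⁻¹ belongs to SO(3), satisfies |R_r(z)|_I < 1, and admits the closed form R_r(z) = (1/(1 + ‖z‖²)) ((1 − ‖z‖²) I + 2 z zᵀ + 2 [z]_×). -/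
open Matrix Filter

noncomputable section

attribute [local instance] Matrix.normedAddCommGroup Matrix.normedSpace

theorem skew_transpose (z : V3) : (skew z)ᵀ = -skew z := by
  ext i j
  fin_cases i <;> fin_cases j <;> simp [skew]

theorem det_one_sub_skew (z : V3) : (1 - skew z).det = 1 + z ⬝ᵥ z := by
  simp [skew, det_fin_three, dotProduct, Fin.sum_univ_three]
  ring

theorem one_add_dotProduct_self_pos (z : V3) : 0 < 1 + z ⬝ᵥ z := by
  have h : 0 ≤ z ⬝ᵥ z := Finset.sum_nonneg fun i _ => mul_self_nonneg (z i)
  linarith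

theorem isUnit_det_one_sub_skew (z : V3) : IsUnit (1 - skew z).det := by
  rw [det_one_sub_skew]
  exact (one_add_dotProduct_self_pos z).ne'.isUnit

theorem transpose_one_sub_skew (z : V3) : (1 - skew z)ᵀ = 1 + skew z := by
  simp [skew_transpose]

theorem transpose_one_add_skew (z : V3) : (1 + skew z)ᵀ = 1 - skew z := by
  simp [skew_transpose, sub_eq_add_neg]

theorem det_one_add_skew (z : V3) : (1 + skew z).det = (1 - skew z).det := by
  rw [← transpose_one_sub_skew, det_transpose]

theorem SO3_Rr (z : V3) : SO3 (Rr z) := by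
  have hu := isUnit_det_one_sub_skew z
  have hu' : IsUnit (1 + skew z).det := by rwa [det_one_add_skew]
  have hcomm : (1 - skew z) * (1 + skew z) = (1 + skew z) * (1 - skew z) := by noncomm_ring
  constructor
  · calc (Rr z)ᵀ * Rr z
        = (1 + skew z)⁻¹ * ((1 - skew z) * (1 + skew z)) * (1 - skew z)⁻¹ := by
          rw [Rr, transpose_mul, transpose_nonsing_inv, transpose_one_sub_skew,
            transpose_one_add_skew]
          simp only [Matrix.mul_assoc]
      _ = 1 := by
          rw [hcomm, nonsing_inv_mul_cancel_left _ _ hu', mul_nonsing_inv _ hu]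
  · rw [Rr, det_mul, det_one_add_skew, ← det_mul, mul_nonsing_inv _ hu, det_one]

theorem Rr_eq (z : V3) : Rr z = (1 + z ⬝ᵥ z)⁻¹ •
    ((1 - z ⬝ᵥ z) • (1 : M3) + (2:ℝ) • vecMulVec z z + (2:ℝ) • skew z) := by
  have key : ((1 - z ⬝ᵥ z) • (1 : M3) + (2:ℝ) • vecMulVec z z + (2:ℝ) • skew z) * (1 - skew z)
      = (1 + z ⬝ᵥ z) • (1 + skew z) := by
    ext i j
    fin_cases i <;> fin_cases j <;>
      simp [skew, mul_apply, dotProduct, Fin.sum_univ_three, vecMulVec_apply] <;> ring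
  have hu := isUnit_det_one_sub_skew z
  rw [← mul_nonsing_inv_cancel_right _ (_ • (_ : M3)) hu, smul_mul_assoc, key,
    inv_smul_smul₀ (one_add_dotProduct_self_pos z).ne', Rr]

theorem normI2_Rr (z : V3) : normI2 (Rr z) = (z ⬝ᵥ z) / (1 + z ⬝ᵥ z) := by
  have h := (one_add_dotProduct_self_pos z).ne'
  have hskew : (skew z).trace = 0 := by simp [skew, trace_fin_three]
  rw [Rr_eq, normI2]
  simp only [trace_sub, trace_smul, trace_add, trace_one, trace_vecMulVec, hskew, smul_eq_mul,
    Fintype.card_fin]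
  field_simp
  push_cast
  ring

/-- `I − [z]ₓ` is invertible, `R_r(z) ∈ SO(3)`, `|R_r(z)|_I < 1`, and
`R_r(z) = (1/(1+‖z‖²))((1−‖z‖²)I + 2zzᵀ + 2[z]ₓ)`. -/
theorem stmt4 (z : V3) :
    IsUnit (1 - skew z) ∧ SO3 (Rr z) ∧ normI2 (Rr z) < 1 ∧
    Rr z = (1 + z ⬝ᵥ z)⁻¹ •
      ((1 - z ⬝ᵥ z) • (1 : M3) + (2:ℝ) • vecMulVec z z + (2:ℝ) • skew z) := by
  refine ⟨(isUnit_iff_isUnit_det _).2 (isUnit_det_one_sub_skew z), SO3_Rr z, ?_, Rr_eq z⟩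
  rw [normI2_Rr, div_lt_one (one_add_dotProduct_self_pos z)]
  linarith

end
end

section
/- Let A be a symmetric real 3×3 matrix such that Ā = (tr(A)I − A)/2 is positive definite, and let R ∈ SO(3). Then ψ(AR) = 0 if and only if R = I or R = R_a(π, v) for some unit eigenvector v of A. -/
open Matrix Filter

noncomputable section

attribute [local instance] Matrix.normedAddCommGroup Matrix.normedSpace

/-- The matrix `(q₀² - |q|²) I + 2 q qᵀ + 2 q₀ [q]ₓ`; a rotation when `q₀² + |q|² = 1`. -/
def quatRot (q₀ : ℝ) (q : V3) : M3 :=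
  (q₀ ^ 2 - q ⬝ᵥ q) • (1 : M3) + (2 : ℝ) • vecMulVec q q + (2 * q₀) • skew q

/-- The symmetric matrix `4 (q₀, q) (q₀, q)ᵀ`, where `R = quatRot q₀ q`, in terms of `R`. -/
def quatGram (R : M3) : Matrix (Fin 4) (Fin 4) ℝ :=
  !![1 + R 0 0 + R 1 1 + R 2 2, R 2 1 - R 1 2, R 0 2 - R 2 0, R 1 0 - R 0 1;
     R 2 1 - R 1 2, 1 + R 0 0 - R 1 1 - R 2 2, R 0 1 + R 1 0, R 0 2 + R 2 0;
     R 0 2 - R 2 0, R 0 1 + R 1 0, 1 - R 0 0 + R 1 1 - R 2 2, R 1 2 + R 2 1;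
     R 1 0 - R 0 1, R 0 2 + R 2 0, R 1 2 + R 2 1, 1 - R 0 0 - R 1 1 + R 2 2]

theorem SO3.transpose_eq_adjugate {R : M3} (hR : SO3 R) : Rᵀ = R.adjugate := by
  have h : R * R.adjugate = 1 := by rw [mul_adjugate, hR.2, one_smul]
  exact left_inv_eq_right_inv hR.1 h

theorem SO3.quatGram_mul {R : M3} (hR : SO3 R) (a b c : Fin 4) :
    quatGram R a b * quatGram R a c = quatGram R a a * quatGram R b c := by
  have h₁ := fun i j => congrFun (congrFun hR.1 i) j
  have hR' : R * Rᵀ = 1 := mul_eq_one_comm.mp hR.1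
  have h₂ := fun i j => congrFun (congrFun hR' i) j
  have h₃ := fun i j => congrFun (congrFun hR.transpose_eq_adjugate i) j
  simp only [Fin.forall_fin_succ, adjugate_fin_three, mul_apply, Fin.sum_univ_three,
    transpose_apply, one_apply] at h₁ h₂ h₃
  simp at h₁ h₂ h₃
  obtain ⟨⟨_, _, _⟩, ⟨_, _, _⟩, _, _, _⟩ := h₁
  obtain ⟨⟨_, _, _⟩, ⟨_, _, _⟩, _, _, _⟩ := h₂
  obtain ⟨⟨_, _, _⟩, ⟨_, _, _⟩, _, _, _⟩ := h₃
  fin_cases a <;> fin_cases b <;> fin_cases c <;> simp [quatGram] <;> linarith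

theorem SO3.exists_quatRot {R : M3} (hR : SO3 R) :
    ∃ (q₀ : ℝ) (q : V3), q₀ ^ 2 + q ⬝ᵥ q = 1 ∧ R = quatRot q₀ q := by
  obtain ⟨a, ha⟩ : ∃ a, 0 < quatGram R a a := by
    by_contra! h
    have := h 0; have := h 1; have := h 2; have := h 3
    simp [quatGram] at *
    linarith
  have hs : √(quatGram R a a) ^ 2 = quatGram R a a := Real.sq_sqrt ha.le
  obtain ⟨p, hp⟩ : ∃ p : Fin 4 → ℝ, ∀ b c, quatGram R b c = 4 * (p b * p c) := by
    refine ⟨fun b => quatGram R a b / (2 * √(quatGram R a a)), fun b c => ?_⟩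
    have := Real.sqrt_pos.mpr ha
    field_simp
    rw [hs]
    linear_combination -4 * hR.quatGram_mul a b c
  refine ⟨p 0, ![p 1, p 2, p 3], ?_, ?_⟩
  all_goals
    simp only [Fin.forall_fin_succ] at hp
    simp [quatGram] at hp
    obtain ⟨⟨_, _, _, _⟩, ⟨_, _, _, _⟩, ⟨_, _, _, _⟩, _, _, _, _⟩ := hp
  · simp [dotProduct, Fin.sum_univ_three]
    linarith
  · ext i j
    fin_cases i <;> fin_cases j <;>
      simp [quatRot, skew, dotProduct, Fin.sum_univ_three] <;> linarith

theorem psi_mul_quatRot {A : M3} (hA : A.IsSymm) (q₀ : ℝ) (q : V3) :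
    psi (A * quatRot q₀ q) = (2 * q₀) • (Abar A *ᵥ q) + crossProduct q (A *ᵥ q) := by
  have h₁ := hA.apply 0 1
  have h₂ := hA.apply 0 2
  have h₃ := hA.apply 1 2
  ext i
  fin_cases i <;>
    simp [psi, vex, Pa, quatRot, Abar, skew, mul_apply, mulVec, dotProduct, Fin.sum_univ_three,
      vecMulVec_apply, trace, cross_apply, h₁, h₂, h₃] <;> ring

theorem quatRot_zero_left {v : V3} (hv : v ⬝ᵥ v = 1) : quatRot 0 v = Ra Real.pi v := by
  have h := hv
  simp only [dotProduct, Fin.sum_univ_three] at h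
  ext i j
  fin_cases i <;> fin_cases j <;>
    simp [quatRot, Ra, skew, hv, vecMulVec_apply] <;> linarith

theorem eq_smul_of_cross_eq_zero {v w : V3} (hv : v ⬝ᵥ v = 1) (h : crossProduct v w = 0) :
    w = (v ⬝ᵥ w) • v := by
  have h' := cross_cross_eq_smul_sub_smul' v v w
  rw [h, map_zero, hv, one_smul] at h'
  exact (sub_eq_zero.mp h'.symm).symm

/-- `ψ(AR) = 0` iff `R = I` or `R = R_a(π, v)` for a unit eigenvector `v` of `A`. -/
theorem stmt7 (A : M3) (hA : A.IsSymm) (hPD : (Abar A).PosDef)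
    (R : M3) (hR : SO3 R) :
    psi (A * R) = 0 ↔
      R = 1 ∨ ∃ v : V3, v ⬝ᵥ v = 1 ∧ (∃ μ : ℝ, A *ᵥ v = μ • v) ∧ R = Ra Real.pi v := by
  constructor
  · intro h
    obtain ⟨q₀, q, hq, rfl⟩ := hR.exists_quatRot
    rw [psi_mul_quatRot hA] at h
    have hdot := congrArg (q ⬝ᵥ ·) h
    simp only [dotProduct_add, dotProduct_smul, dot_self_cross, dotProduct_zero, add_zero,
      smul_eq_mul] at hdot
    rcases eq_or_ne q 0 with rfl | hne
    · left
      simp only [dotProduct_zero, add_zero] at hq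
      ext i j
      fin_cases i <;> fin_cases j <;> simp [quatRot, skew, hq]
    · right
      have hpos : 0 < q ⬝ᵥ (Abar A *ᵥ q) := by simpa using hPD.dotProduct_mulVec_pos hne
      obtain rfl : q₀ = 0 := by simpa [hpos.ne'] using hdot
      have hq1 : q ⬝ᵥ q = 1 := by simpa using hq
      exact ⟨q, hq1, ⟨_, eq_smul_of_cross_eq_zero hq1 (by simpa using h)⟩, quatRot_zero_left hq1⟩
  · rintro (rfl | ⟨v, hv, ⟨μ, hμ⟩, rfl⟩)
    · simp [psi, Pa, vex, hA.eq]
    · rw [← quatRot_zero_left hv, psi_mul_quatRot hA, hμ]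
      simp

end
end

section
/- Let A be a symmetric real 3×3 matrix such that Ā = (tr(A)I − A)/2 is positive definite, with smallest and largest eigenvalues λ_min and λ_max. Let R̃ : [0,∞) → ℝ^{3×3} be differentiable with R̃(t) ∈ SO(3) and R̃'(t) = R̃(t)[σ(t)]_× where σ(t) = −ψ(A R̃(t)), and suppose |R̃(0)|_I < 1. Then for all t ≥ 0, s e^{−λ_max t}/√(1 − s²(1 − e^{−2λ_max t})) ≤ |R̃(t)|_I ≤ s e^{−λ_min t}/√(1 − s²(1 − e^{−2λ_min t})), where s = |R̃(0)|_I. -/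
open Matrix Filter

noncomputable section

attribute [local instance] Matrix.normedAddCommGroup Matrix.normedSpace

theorem dotProduct_mulVec_eq_sum_eigenvalues {B : M3} (hB : B.IsHermitian) (w : V3) :
    ∃ y : V3, y ⬝ᵥ y = w ⬝ᵥ w ∧ w ⬝ᵥ B *ᵥ w = ∑ i, hB.eigenvalues i * y i ^ 2 := by
  set U : M3 := (hB.eigenvectorUnitary : M3) with hU
  have hUU : U * Uᵀ = 1 := by
    simpa [star_eq_conjTranspose] using
      (mem_unitaryGroup_iff).1 hB.eigenvectorUnitary.2
  have hspec : B = U * diagonal hB.eigenvalues * Uᵀ := by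
    have h := hB.spectral_theorem
    rw [Unitary.conjStarAlgAut_apply] at h
    simpa [star_eq_conjTranspose, Function.comp_def] using h
  refine ⟨Uᵀ *ᵥ w, ?_, ?_⟩
  · rw [dotProduct_mulVec, vecMul_transpose, mulVec_mulVec, hUU, one_mulVec]
  · conv_lhs => rw [hspec]
    rw [← mulVec_mulVec, ← mulVec_mulVec, dotProduct_mulVec, ← mulVec_transpose]
    simp only [dotProduct, mulVec_diagonal]
    exact Finset.sum_congr rfl fun i _ => by ring

theorem lmin_mul_le_dotProduct_mulVec {B : M3} (hB : B.PosDef) (w : V3) :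
    lmin hB * (w ⬝ᵥ w) ≤ w ⬝ᵥ B *ᵥ w := by
  obtain ⟨y, hy, h⟩ := dotProduct_mulVec_eq_sum_eigenvalues hB.1 w
  rw [h, ← hy, dotProduct, Finset.mul_sum]
  refine Finset.sum_le_sum fun i _ => ?_
  rw [← sq]
  exact mul_le_mul_of_nonneg_right (ciInf_le (Set.finite_range _).bddBelow i) (sq_nonneg _)

theorem dotProduct_mulVec_le_lmax_mul {B : M3} (hB : B.PosDef) (w : V3) :
    w ⬝ᵥ B *ᵥ w ≤ lmax hB * (w ⬝ᵥ w) := by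
  obtain ⟨y, hy, h⟩ := dotProduct_mulVec_eq_sum_eigenvalues hB.1 w
  rw [h, ← hy, dotProduct, Finset.mul_sum]
  refine Finset.sum_le_sum fun i _ => ?_
  rw [← sq]
  exact mul_le_mul_of_nonneg_right (le_ciSup (Set.finite_range _).bddAbove i) (sq_nonneg _)

theorem SO3.psi_dotProduct_psi {R : M3} (hR : SO3 R) :
    psi R ⬝ᵥ psi R = 4 * (normI2 R * (1 - normI2 R)) := by
  have hadj : R.adjugate = Rᵀ := by
    rw [← one_mul R.adjugate, ← hR.1, Matrix.mul_assoc, mul_adjugate, hR.2, one_smul,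
      Matrix.mul_one]
  have h (i : Fin 3) := congrFun₂ hadj i i
  have h0 := h 0
  have h1 := h 1
  have h2 := h 2
  have ht := congrArg trace hR.1
  rw [adjugate_fin_three] at h0 h1 h2
  simp [trace_fin_three, Matrix.mul_apply, Fin.sum_univ_three] at h0 h1 h2 ht
  simp [psi, vex, Pa, normI2, trace_fin_three, dotProduct, Fin.sum_univ_three]
  linear_combination (1 / 4) * ht + (1 / 2) * (h0 + h1 + h2)

theorem SO3.psi_dotProduct_psi_mul {A R : M3} (hA : A.IsSymm) (hR : SO3 R) :
    psi R ⬝ᵥ psi (A * R) = psi R ⬝ᵥ Abar A *ᵥ psi R := by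
  have hcomm : R * Rᵀ = Rᵀ * R := hR.1 ▸ mul_eq_one_comm.1 hR.1
  have h (i j : Fin 3) := congrFun₂ hcomm i j
  have h00 := h 0 0
  have h01 := h 0 1
  have h02 := h 0 2
  have h11 := h 1 1
  have h12 := h 1 2
  have h22 := h 2 2
  simp [Matrix.mul_apply, Fin.sum_univ_three] at h00 h01 h02 h11 h12 h22
  simp [psi, vex, Pa, Abar, trace_fin_three, dotProduct, mulVec, Fin.sum_univ_three,
    Matrix.mul_apply, hA.apply 0 1, hA.apply 0 2, hA.apply 1 2]
  linear_combination (1 / 8) * (A 0 0 * h00 + A 1 1 * h11 + A 2 2 * h22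
    + 2 * A 0 1 * h01 + 2 * A 0 2 * h02 + 2 * A 1 2 * h12)

theorem trace_mul_skew (R : M3) (x : V3) : (R * skew x).trace = -2 * (psi R ⬝ᵥ x) := by
  simp [psi, vex, Pa, skew, trace_fin_three, dotProduct, Fin.sum_univ_three, Matrix.mul_apply]
  ring

theorem SO3.normI2_nonneg {R : M3} (hR : SO3 R) : 0 ≤ normI2 R := by
  have ht := congrArg trace hR.1
  simp [trace_fin_three, Matrix.mul_apply, Fin.sum_univ_three] at ht
  simp [normI2, trace_fin_three]
  nlinarith [sq_nonneg (R 0 0 - 1), sq_nonneg (R 1 1 - 1), sq_nonneg (R 2 2 - 1),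
    sq_nonneg (R 0 1), sq_nonneg (R 0 2), sq_nonneg (R 1 0), sq_nonneg (R 1 2),
    sq_nonneg (R 2 0), sq_nonneg (R 2 1)]

theorem HasDerivWithinAt.normI2 {R : ℝ → M3} {R' : M3} {S : Set ℝ} {t : ℝ}
    (h : HasDerivWithinAt R R' S t) :
    HasDerivWithinAt (fun u => normI2 (R u)) (-R'.trace / 4) S t := by
  have h' := (LinearMap.toContinuousLinearMap (traceLinearMap (Fin 3) ℝ ℝ)).hasFDerivAt
    |>.comp_hasDerivWithinAt t h
  have hf : (fun u => _root_.normI2 (R u)) = fun u => (3 - (R u).trace) / 4 := by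
    ext u
    simp [_root_.normI2]
  rw [hf]
  exact (h'.const_sub 3).div_const 4

/-- The odds `V / (1 - V)` rescaled by `exp (2 l t)`, differentiated along a curve. -/
theorem HasDerivAt.odds_mul_exp {V : ℝ → ℝ} {V' t : ℝ} (l : ℝ) (hV : HasDerivAt V V' t)
    (h1 : V t < 1) :
    HasDerivAt (fun u => V u / (1 - V u) * Real.exp (2 * l * u))
      (Real.exp (2 * l * t) * (V' + 2 * l * (V t * (1 - V t))) / (1 - V t) ^ 2) t := by
  have hne : 1 - V t ≠ 0 := by linarith
  have he : HasDerivAt (fun u => Real.exp (2 * l * u)) (Real.exp (2 * l * t) * (2 * l)) t := by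
    simpa using ((hasDerivAt_id t).const_mul (2 * l)).exp
  refine ((hV.div (hV.const_sub 1) hne).mul he).congr_deriv ?_
  simp only [Pi.div_apply]
  field_simp
  ring

theorem logistic_eq {x l t : ℝ} (hx : 0 ≤ x) :
    Real.sqrt x * Real.exp (-l * t) / Real.sqrt (1 - Real.sqrt x ^ 2 *
      (1 - Real.exp (-2 * l * t))) =
    Real.sqrt (x * Real.exp (-2 * l * t) / (1 - x * (1 - Real.exp (-2 * l * t)))) := by
  have he : Real.exp (-2 * l * t) = Real.exp (-l * t) ^ 2 := by
    rw [← Real.exp_nat_mul]; congr 1; push_cast; ring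
  rw [Real.sq_sqrt hx, Real.sqrt_div (by positivity), Real.sqrt_mul hx, he,
    Real.sqrt_sq (Real.exp_pos _).le]

theorem le_logistic_iff {x y l t : ℝ} (hx : 0 ≤ x) (hx1 : x < 1) (hy1 : y < 1) :
    y ≤ x * Real.exp (-2 * l * t) / (1 - x * (1 - Real.exp (-2 * l * t))) ↔
      y / (1 - y) * Real.exp (2 * l * t) ≤ x / (1 - x) := by
  have he : Real.exp (-2 * l * t) = (Real.exp (2 * l * t))⁻¹ := by
    rw [← Real.exp_neg]; congr 1; ring
  have hE := Real.exp_pos (2 * l * t)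
  rw [he]
  set E := Real.exp (2 * l * t)
  have hEi : 0 < E⁻¹ := by positivity
  have hEE : E * E⁻¹ = 1 := mul_inv_cancel₀ hE.ne'
  rw [le_div_iff₀ (by nlinarith), div_mul_eq_mul_div, div_le_div_iff₀ (by linarith) (by linarith),
    ← mul_le_mul_iff_of_pos_left hE]
  exact ⟨fun h => by linear_combination h - (y * x - x) * hEE,
    fun h => by linear_combination h + (y * x - x) * hEE⟩

theorem logistic_le_iff {x y l t : ℝ} (hx : 0 ≤ x) (hx1 : x < 1) (hy1 : y < 1) :
    x * Real.exp (-2 * l * t) / (1 - x * (1 - Real.exp (-2 * l * t))) ≤ y ↔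
      x / (1 - x) ≤ y / (1 - y) * Real.exp (2 * l * t) := by
  have he : Real.exp (-2 * l * t) = (Real.exp (2 * l * t))⁻¹ := by
    rw [← Real.exp_neg]; congr 1; ring
  have hE := Real.exp_pos (2 * l * t)
  rw [he]
  set E := Real.exp (2 * l * t)
  have hEi : 0 < E⁻¹ := by positivity
  have hEE : E * E⁻¹ = 1 := mul_inv_cancel₀ hE.ne'
  rw [div_le_iff₀ (by nlinarith), div_mul_eq_mul_div, div_le_div_iff₀ (by linarith) (by linarith),
    ← mul_le_mul_iff_of_pos_left hE]
  exact ⟨fun h => by linear_combination h + (y * x - x) * hEE,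
    fun h => by linear_combination h - (y * x - x) * hEE⟩

/-- comparison bounds for `|R̃(t)|_I` for the Filter I error dynamics. -/
theorem stmt11 (A : M3) (hA : A.IsSymm) (hPD : (Abar A).PosDef)
    (Rt : ℝ → M3) (σ : ℝ → V3) (hσ : ∀ t, σ t = -psi (A * Rt t))
    (hSO : ∀ t, 0 ≤ t → SO3 (Rt t))
    (hR' : ∀ t, 0 ≤ t → HasDerivWithinAt Rt (Rt t * skew (σ t)) (Set.Ici 0) t)
    (h0 : normI2 (Rt 0) < 1) (s : ℝ) (hs : s = Real.sqrt (normI2 (Rt 0))) :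
    ∀ t, 0 ≤ t →
      s * Real.exp (-(lmax hPD) * t) /
          Real.sqrt (1 - s ^ 2 * (1 - Real.exp (-2 * lmax hPD * t))) ≤
        Real.sqrt (normI2 (Rt t)) ∧
      Real.sqrt (normI2 (Rt t)) ≤
        s * Real.exp (-(lmin hPD) * t) /
          Real.sqrt (1 - s ^ 2 * (1 - Real.exp (-2 * lmin hPD * t))) := by
  have hV' (t : ℝ) (ht : 0 ≤ t) : HasDerivWithinAt (fun u => normI2 (Rt u))
      (-(psi (Rt t) ⬝ᵥ Abar A *ᵥ psi (Rt t)) / 2) (Set.Ici 0) t := by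
    convert (hR' t ht).normI2 using 1
    rw [trace_mul_skew, hσ, dotProduct_neg, (hSO t ht).psi_dotProduct_psi_mul hA]
    ring
  have hVd (t : ℝ) (ht : t ∈ interior (Set.Ici (0 : ℝ))) : HasDerivAt (fun u => normI2 (Rt u))
      (-(psi (Rt t) ⬝ᵥ Abar A *ᵥ psi (Rt t)) / 2) t := by
    rw [interior_Ici] at ht
    exact (hV' t (le_of_lt ht)).hasDerivAt (Ici_mem_nhds ht)
  have hVc : ContinuousOn (fun u => normI2 (Rt u)) (Set.Ici 0) :=
    fun t ht => (hV' t ht).continuousWithinAt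
  have hanti : AntitoneOn (fun u => normI2 (Rt u)) (Set.Ici 0) := by
    refine antitoneOn_of_deriv_nonpos (convex_Ici 0) hVc
      (fun t ht => (hVd t ht).differentiableAt.differentiableWithinAt) fun t ht => ?_
    rw [(hVd t ht).deriv]
    have := hPD.posSemidef.dotProduct_mulVec_nonneg (psi (Rt t))
    rw [star_trivial] at this
    linarith
  have hV1 (t : ℝ) (ht : 0 ≤ t) : normI2 (Rt t) < 1 :=
    (hanti Set.self_mem_Ici ht ht).trans_lt h0
  have hQc (l : ℝ) : ContinuousOn
      (fun u => normI2 (Rt u) / (1 - normI2 (Rt u)) * Real.exp (2 * l * u)) (Set.Ici 0) :=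
    (hVc.div (continuousOn_const.sub hVc) fun t ht => (sub_pos.2 (hV1 t ht)).ne').mul
      (by fun_prop)
  have hQd (l t : ℝ) (ht : t ∈ interior (Set.Ici (0 : ℝ))) :=
    (hVd t ht).odds_mul_exp l (hV1 t (interior_subset ht))
  have hnn := (hSO 0 le_rfl).normI2_nonneg
  intro t ht
  rw [hs, logistic_eq hnn, logistic_eq hnn]
  refine ⟨Real.sqrt_le_sqrt ?_, Real.sqrt_le_sqrt ?_⟩
  · rw [logistic_le_iff hnn h0 (hV1 t ht)]
    have hmono := monotoneOn_of_deriv_nonneg (convex_Ici 0) (hQc (lmax hPD))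
      (fun t ht => (hQd _ t ht).differentiableAt.differentiableWithinAt) fun t ht => by
        rw [(hQd _ t ht).deriv]
        have := dotProduct_mulVec_le_lmax_mul hPD (psi (Rt t))
        rw [(hSO t (interior_subset ht)).psi_dotProduct_psi] at this
        exact div_nonneg (mul_nonneg (Real.exp_pos _).le (by linarith)) (sq_nonneg _)
    simpa using hmono Set.self_mem_Ici ht ht
  · rw [le_logistic_iff hnn h0 (hV1 t ht)]
    have hmono := antitoneOn_of_deriv_nonpos (convex_Ici 0) (hQc (lmin hPD))
      (fun t ht => (hQd _ t ht).differentiableAt.differentiableWithinAt) fun t ht => by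
        rw [(hQd _ t ht).deriv]
        have := lmin_mul_le_dotProduct_mulVec hPD (psi (Rt t))
        rw [(hSO t (interior_subset ht)).psi_dotProduct_psi] at this
        exact div_nonpos_of_nonpos_of_nonneg
          (mul_nonpos_of_nonneg_of_nonpos (Real.exp_pos _).le (by linarith)) (sq_nonneg _)
    simpa using hmono Set.self_mem_Ici ht ht

end
end

section
/- Let Ā be a symmetric positive-definite real 3×3 matrix, let λ > 0 be an eigenvalue of Ā and z₀ ∈ ℝ³ a corresponding unit eigenvector (Ā z₀ = λ z₀, ‖z₀‖ = 1). Define the disturbance d(t) = −2λ z₀ (2λt + 1)^{−1/2} for t ≥ 0. Then the curve Z(t) = z₀ (2λt + 1)^{1/2} satisfies Z(0) = z₀ and solves the differential equation Z'(t) = −Ā Z(t) − g(Z(t)) d(t) for all t ≥ 0, where g(z) = (1/2)(I + [z]_× + z zᵀ). In particular ‖Z(t)‖ = (2λt+1)^{1/2} → ∞ as t → ∞ even though d(t) is bounded and vanishes as t → ∞. -/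
open Matrix Filter

noncomputable section

attribute [local instance] Matrix.normedAddCommGroup Matrix.normedSpace

/-- The Rodrigues map `g(z)` acts along the direction of `z` by the scalar `(1 + ‖z‖²) / 2`,
here with `z = s u` for a unit vector `u`. -/
lemma gmat_smul_mulVec_smul (u : V3) (hu : u ⬝ᵥ u = 1) (s c : ℝ) :
    gmat (s • u) *ᵥ (c • u) = ((1 + s ^ 2) / 2 * c) • u := by
  have hskew : skew (s • u) *ᵥ u = 0 := by
    ext i
    fin_cases i <;> simp [skew, Matrix.mulVec, dotProduct, Fin.sum_univ_three] <;> ring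
  rw [mulVec_smul, gmat, smul_mulVec, add_mulVec, add_mulVec, one_mulVec, hskew,
    vecMulVec_mulVec, smul_dotProduct, hu]
  ext i
  simp
  ring

/-- a bounded, vanishing disturbance driving the Filter I
Rodrigues-error dynamics `Z' = −ĀZ − g(Z) d` to infinity. -/
theorem stmt15 (Ab : M3) (hPD : Ab.PosDef) (lam : ℝ) (hlam : 0 < lam)
    (z₀ : V3) (heig : Ab *ᵥ z₀ = lam • z₀) (hunit : z₀ ⬝ᵥ z₀ = 1)
    (d : ℝ → V3)
    (hd : ∀ t, d t = -((2 * lam * (Real.sqrt (2 * lam * t + 1))⁻¹) • z₀))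
    (Z : ℝ → V3) (hZ : ∀ t, Z t = Real.sqrt (2 * lam * t + 1) • z₀) :
    Z 0 = z₀ ∧
    (∀ t, 0 ≤ t →
      HasDerivWithinAt Z (-(Ab *ᵥ Z t) - gmat (Z t) *ᵥ d t) (Set.Ici 0) t) ∧
    (∀ t, 0 ≤ t → Real.sqrt (Z t ⬝ᵥ Z t) = Real.sqrt (2 * lam * t + 1)) ∧
    Tendsto (fun t => Real.sqrt (Z t ⬝ᵥ Z t)) atTop atTop := by
  obtain rfl : Z = fun t => Real.sqrt (2 * lam * t + 1) • z₀ := funext hZ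
  have hnorm (t : ℝ) (ht : 0 ≤ t) :
      Real.sqrt ((Real.sqrt (2 * lam * t + 1) • z₀) ⬝ᵥ (Real.sqrt (2 * lam * t + 1) • z₀)) =
        Real.sqrt (2 * lam * t + 1) := by
    have hpos : 0 ≤ 2 * lam * t + 1 := by positivity
    rw [smul_dotProduct, dotProduct_smul, hunit, smul_eq_mul, smul_eq_mul, mul_one,
      Real.mul_self_sqrt hpos]
  refine ⟨by simp, fun t ht => ?_, hnorm, ?_⟩
  · have hpos : 0 < 2 * lam * t + 1 := by positivity
    have hlin : HasDerivAt (fun t : ℝ => 2 * lam * t + 1) (2 * lam) t := by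
      simpa using ((hasDerivAt_id t).const_mul (2 * lam)).add_const 1
    have hderiv := ((hlin.sqrt hpos.ne').smul_const z₀).hasDerivWithinAt (s := Set.Ici 0)
    have hs : Real.sqrt (2 * lam * t + 1) ≠ 0 := (Real.sqrt_pos.mpr hpos).ne'
    have hfield : -(Ab *ᵥ (Real.sqrt (2 * lam * t + 1) • z₀)) -
        gmat (Real.sqrt (2 * lam * t + 1) • z₀) *ᵥ d t =
          (2 * lam / (2 * Real.sqrt (2 * lam * t + 1))) • z₀ := by
      rw [hd, ← neg_smul, gmat_smul_mulVec_smul z₀ hunit, mulVec_smul, heig, smul_smul,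
        ← neg_smul, ← sub_smul]
      congr 1
      field_simp
      ring
    exact hfield ▸ hderiv
  · have hlin : Tendsto (fun t : ℝ => 2 * lam * t + 1) atTop atTop :=
      tendsto_atTop_add_const_right _ _ (tendsto_id.const_mul_atTop (by positivity))
    refine (Real.tendsto_sqrt_atTop.comp hlin).congr' ?_
    filter_upwards [eventually_ge_atTop 0] with t ht
    exact (hnorm t ht).symm

end
end

section
/- Let Ā be a symmetric positive-definite real 3×3 matrix with smallest eigenvalue λ_min, let ε > 0, and for i ∈ {1,2,3} define k₁(z) = 1, k₂(z) = ((1+‖z‖²)/(1+ε(1+‖z‖²)))^{1/2}, k₃(z) = (1+‖z‖²)/(1+ε(1+‖z‖²)). Let R̂ : [0,∞) → SO(3) and n_ω : [0,∞) → ℝ³, and let Z : [0,∞) → ℝ³ be differentiable with Z'(t) = −k_i(Z(t)) Ā Z(t) − g(Z(t)) R̂(t) n_ω(t). Then (d/dt)(½‖Z(t)‖²) = −k_i(Z(t)) Z(t)ᵀ Ā Z(t) − ½(1+‖Z(t)‖²) Z(t)ᵀ R̂(t) n_ω(t); moreover, for any 0 < ϱ < 1, at every time t at which (1+‖Z(t)‖²)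 ‖n_ω(t)‖ ≤ 2 ϱ λ_min k_i(Z(t)) ‖Z(t)‖, one has (d/dt)(½‖Z(t)‖²) ≤ −λ_min (1−ϱ) k_i(Z(t)) ‖Z(t)‖². -/
open Matrix Filter

noncomputable section

attribute [local instance] Matrix.normedAddCommGroup Matrix.normedSpace

/-- The quadratic form of a positive-definite matrix is bounded below by its smallest eigenvalue. -/
theorem lmin_mul_dotProduct_self_le {B : M3} (hB : B.PosDef) (v : V3) :
    lmin hB * (v ⬝ᵥ v) ≤ v ⬝ᵥ (B *ᵥ v) := by
  have hH : (B - algebraMap ℝ M3 (lmin hB)).IsHermitian := by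
    refine hB.1.sub ?_
    rw [algebraMap_eq_diagonal]
    exact isHermitian_diagonal _
  have hpsd : (B - algebraMap ℝ M3 (lmin hB)).PosSemidef := by
    rw [hH.posSemidef_iff_eigenvalues_nonneg]
    intro i
    have hi := hH.eigenvalues_mem_spectrum_real i
    rw [← spectrum.sub_singleton_eq, hB.1.spectrum_real_eq_range_eigenvalues] at hi
    obtain ⟨_, ⟨j, rfl⟩, _, rfl, h⟩ := hi
    rw [Pi.zero_apply, ← h]
    exact sub_nonneg.mpr (ciInf_le (Set.finite_range _).bddBelow j)
  have h := hpsd.dotProduct_mulVec_nonneg v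
  rw [sub_mulVec, dotProduct_sub, star_trivial, Algebra.algebraMap_eq_smul_one, smul_mulVec,
    one_mulVec, dotProduct_smul, smul_eq_mul] at h
  linarith

theorem SO3.dotProduct_mulVec_self {R : M3} (hR : SO3 R) (v : V3) :
    (R *ᵥ v) ⬝ᵥ (R *ᵥ v) = v ⬝ᵥ v := by
  rw [dotProduct_mulVec, ← mulVec_transpose, mulVec_mulVec, hR.1, one_mulVec]

theorem abs_dotProduct_le_sqrt_mul_sqrt {n : Type*} [Fintype n] (v w : n → ℝ) :
    |v ⬝ᵥ w| ≤ √(v ⬝ᵥ v) * √(w ⬝ᵥ w) := by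
  simp only [dotProduct, ← sq]
  rw [← Real.sqrt_mul (Finset.sum_nonneg fun _ _ ↦ sq_nonneg _)]
  exact Real.abs_le_sqrt (Finset.sum_mul_sq_le_sq_mul_sq _ _ _)

theorem dotProduct_gmat_mulVec (z w : V3) :
    z ⬝ᵥ (gmat z *ᵥ w) = (1 / 2) * (1 + z ⬝ᵥ z) * (z ⬝ᵥ w) := by
  simp [gmat, skew, dotProduct, mulVec, vecMulVec, Fin.sum_univ_three, one_apply]
  ring

theorem HasDerivWithinAt.half_dotProduct_self {n : Type*} [Fintype n] {f : ℝ → n → ℝ}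
    {f' : n → ℝ} {s : Set ℝ} {t : ℝ} (hf : HasDerivWithinAt f f' s t) :
    HasDerivWithinAt (fun x ↦ (1 / 2) * (f x ⬝ᵥ f x)) (f t ⬝ᵥ f') s t := by
  rw [hasDerivWithinAt_pi] at hf
  have h := (HasDerivWithinAt.fun_sum fun i (_ : i ∈ Finset.univ) ↦
    (hf i).mul (hf i)).const_mul (1 / 2 : ℝ)
  refine h.congr_deriv ?_
  rw [dotProduct, Finset.mul_sum]
  exact Finset.sum_congr rfl fun i _ ↦ by ring

/-- derivative of `½‖Z‖²` along the disturbed error dynamics of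
Filters I, II, III, and its decrease whenever the disturbance is small enough. -/
theorem stmt16 (Ab : M3) (hPD : Ab.PosDef) (ε : ℝ) (hε : 0 < ε)
    (k : V3 → ℝ)
    (hk : k = (fun _ => (1:ℝ)) ∨
          k = (fun z => Real.sqrt ((1 + z ⬝ᵥ z) / (1 + ε * (1 + z ⬝ᵥ z)))) ∨
          k = (fun z => (1 + z ⬝ᵥ z) / (1 + ε * (1 + z ⬝ᵥ z))))
    (Rhat : ℝ → M3) (hRhat : ∀ t, SO3 (Rhat t))
    (nω : ℝ → V3) (Z : ℝ → V3)
    (hZ' : ∀ t, 0 ≤ t →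
      HasDerivWithinAt Z
        (-(k (Z t) • (Ab *ᵥ Z t)) - gmat (Z t) *ᵥ (Rhat t *ᵥ nω t))
        (Set.Ici 0) t) :
    (∀ t, 0 ≤ t →
      HasDerivWithinAt (fun s => (1/2) * (Z s ⬝ᵥ Z s))
        (-(k (Z t) * (Z t ⬝ᵥ (Ab *ᵥ Z t))) -
          (1/2) * (1 + Z t ⬝ᵥ Z t) * (Z t ⬝ᵥ (Rhat t *ᵥ nω t)))
        (Set.Ici 0) t) ∧
    ∀ ϱ : ℝ, 0 < ϱ → ϱ < 1 → ∀ t, 0 ≤ t →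
      (1 + Z t ⬝ᵥ Z t) * Real.sqrt (nω t ⬝ᵥ nω t) ≤
          2 * ϱ * lmin hPD * k (Z t) * Real.sqrt (Z t ⬝ᵥ Z t) →
      -(k (Z t) * (Z t ⬝ᵥ (Ab *ᵥ Z t))) -
          (1/2) * (1 + Z t ⬝ᵥ Z t) * (Z t ⬝ᵥ (Rhat t *ᵥ nω t)) ≤
        -(lmin hPD) * (1 - ϱ) * k (Z t) * (Z t ⬝ᵥ Z t) := by
  have hk0 (z : V3) : 0 ≤ k z := by
    have hz : 0 ≤ z ⬝ᵥ z := by simpa using dotProduct_star_self_nonneg z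
    rcases hk with rfl | rfl | rfl <;> positivity
  refine ⟨fun t ht ↦ (hZ' t ht).half_dotProduct_self.congr_deriv ?_, fun ϱ _ _ t _ hn ↦ ?_⟩
  · rw [dotProduct_sub, dotProduct_neg, dotProduct_smul, dotProduct_gmat_mulVec, smul_eq_mul]
  · have hz : 0 ≤ Z t ⬝ᵥ Z t := by simpa using dotProduct_star_self_nonneg (Z t)
    have hA := mul_le_mul_of_nonneg_left (lmin_mul_dotProduct_self_le hPD (Z t)) (hk0 (Z t))
    have hcs := neg_le_of_abs_le (abs_dotProduct_le_sqrt_mul_sqrt (Z t) (Rhat t *ᵥ nω t))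
    rw [(hRhat t).dotProduct_mulVec_self] at hcs
    have hd := mul_le_mul_of_nonneg_left hcs (by positivity : 0 ≤ 1 + Z t ⬝ᵥ Z t)
    have hs := mul_le_mul_of_nonneg_left hn (Real.sqrt_nonneg (Z t ⬝ᵥ Z t))
    have hsq : 2 * ϱ * lmin hPD * k (Z t) * (√(Z t ⬝ᵥ Z t) * √(Z t ⬝ᵥ Z t)) =
        2 * ϱ * lmin hPD * k (Z t) * (Z t ⬝ᵥ Z t) := by rw [Real.mul_self_sqrt hz]
    linarith

end
end
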